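/- arXiv:1802.03132 — 2 statements merged into one kernel-verified Lean document; each statement's English description precedes it below -/
import Mathlib

section
/- Let Γ be a family of rectifiable curves in a metric measure space (X,d,μ), and suppose a₀ := essℓ(Γ) < ∞. Then Γ(a₀) = {γ∈Γ : length(γ) < a₀} is ∞-exceptional. -/
open MeasureTheory
open scoped ENNReal

/-- A *curve* in a metric space `X`: a nonconstant continuous map from a compact
interval `[a,b] ⊆ ℝ` into `X`. -/
structure Curve (X : Type*) [MetricSpace X] where
  a : ℝ
  b : ℝ
  hab : a ≤ b
  toFun : ℝ → X
  cont : ContinuousOn toFun (Set.Icc a b)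
  nonconst : ∃ s ∈ Set.Icc a b, ∃ t ∈ Set.Icc a b, toFun s ≠ toFun t

namespace Curve

variable {X : Type*} [MetricSpace X]

/-- The length of a curve: the total variation of `γ` on `[a,b]`. -/
noncomputable def length (γ : Curve X) : ℝ≥0∞ :=
  eVariationOn γ.toFun (Set.Icc γ.a γ.b)

/-- A curve is rectifiable if it has finite length. -/
def Rectifiable (γ : Curve X) : Prop := γ.length ≠ ∞

/-- The length function `s_γ(t) = length (γ|_[a,t])`. -/
noncomputable def lenFun (γ : Curve X) (t : ℝ) : ℝ :=
  (eVariationOn γ.toFun (Set.Icc γ.a t)).toReal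

/-- The right inverse `s_γ⁻¹(t) = max {s ∈ [a,b] : s_γ(s) = t}` of the length function. -/
noncomputable def lenInv (γ : Curve X) (t : ℝ) : ℝ :=
  sSup {s | s ∈ Set.Icc γ.a γ.b ∧ γ.lenFun s = t}

/-- The arc-length parametrization `γ_s(t) = γ(s_γ⁻¹(t))`. -/
noncomputable def param (γ : Curve X) (t : ℝ) : X := γ.toFun (γ.lenInv t)

/-- The parameter domain `[0, length γ]` of the arc-length parametrization,
as a subset of `ℝ` (it is all of `[0,∞)` when `γ` has infinite length). -/
def paramDomain (γ : Curve X) : Set ℝ := {t : ℝ | 0 ≤ t ∧ ENNReal.ofReal t ≤ γ.length}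

/-- The line integral `∫_γ ρ ds = ∫_0^{length γ} ρ(γ_s(t)) dt` of a density `ρ` along `γ`. -/
noncomputable def lineIntegral (γ : Curve X) (ρ : X → ℝ≥0∞) : ℝ≥0∞ :=
  ∫⁻ t in γ.paramDomain, ρ (γ.param t)

/-- `σ` is a subcurve of `γ` if it is the restriction of `γ` to a subinterval. -/
def IsSubcurve (σ γ : Curve X) : Prop :=
  γ.a ≤ σ.a ∧ σ.b ≤ γ.b ∧ ∀ t ∈ Set.Icc σ.a σ.b, σ.toFun t = γ.toFun t

/-- A curve is locally rectifiable if every interior point of its parameter interval has a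
neighbourhood on which the curve is rectifiable. -/
def LocallyRectifiable (γ : Curve X) : Prop :=
  ∀ t ∈ Set.Ioo γ.a γ.b, ∃ u v : ℝ, u < t ∧ t < v ∧
    eVariationOn γ.toFun (Set.Icc (max γ.a u) (min γ.b v)) ≠ ∞

/-- A curve has positive length in a set `F`: `m₁(γ_s⁻¹(F)) > 0`. -/
def PosLength (γ : Curve X) (F : Set X) : Prop :=
  0 < volume (γ.paramDomain ∩ γ.param ⁻¹' F)

end Curve

section Modulus

variable {X : Type*} [MetricSpace X] [MeasurableSpace X] [BorelSpace X]

/-- A density (nonnegative Borel function) `ρ` is admissible for a curve family `Γ`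
if `∫_γ ρ ds ≥ 1` for every `γ ∈ Γ`. -/
def Admissible (Γ : Set (Curve X)) (ρ : X → ℝ≥0∞) : Prop :=
  Measurable ρ ∧ ∀ γ ∈ Γ, 1 ≤ γ.lineIntegral ρ

/-- The supremum-modulus `Mod_sup(Γ) = inf {sup_X ρ : ρ ∈ Adm(Γ)}`. -/
noncomputable def ModSup (Γ : Set (Curve X)) : ℝ≥0∞ :=
  ⨅ ρ ∈ {ρ : X → ℝ≥0∞ | Admissible Γ ρ}, ⨆ x, ρ x

/-- `Mod_∞^*(Γ) = inf {‖ρ‖_∞ : ρ ∈ Adm(Γ)}`. -/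
noncomputable def ModInfty (μ : Measure X) (Γ : Set (Curve X)) : ℝ≥0∞ :=
  ⨅ ρ ∈ {ρ : X → ℝ≥0∞ | Admissible Γ ρ}, essSup ρ μ

/-- A curve family is `∞`-exceptional if `Mod_∞^*(Γ) = 0`. -/
def Exceptional (μ : Measure X) (Γ : Set (Curve X)) : Prop :=
  ModInfty μ Γ = 0

/-- `ρ` is weakly admissible for `Γ` if `∫_γ ρ ds ≥ 1` for `∞`-a.e. curve `γ ∈ Γ`. -/
def WeaklyAdmissible (μ : Measure X) (Γ : Set (Curve X)) (ρ : X → ℝ≥0∞) : Prop :=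
  Measurable ρ ∧ Exceptional μ {γ ∈ Γ | γ.lineIntegral ρ < 1}

/-- The `∞`-modulus `Mod_∞(Γ) = inf {‖ρ‖_∞ : ρ weakly admissible for Γ}`. -/
noncomputable def ModInftyW (μ : Measure X) (Γ : Set (Curve X)) : ℝ≥0∞ :=
  ⨅ ρ ∈ {ρ : X → ℝ≥0∞ | WeaklyAdmissible μ Γ ρ}, essSup ρ μ

/-- The essential length `essℓ(Γ) = sup {a ≥ 0 : Γ(a) = {γ ∈ Γ : length γ < a} is ∞-exceptional}`. -/
noncomputable def essLen (μ : Measure X) (Γ : Set (Curve X)) : ℝ≥0∞ :=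
  sSup {a : ℝ≥0∞ | Exceptional μ {γ ∈ Γ | γ.length < a}}

/-- The family `Γ(x,y)` of rectifiable curves connecting `x` to `y`. -/
def ConnCurves (x y : X) : Set (Curve X) :=
  {γ : Curve X | γ.Rectifiable ∧ γ.toFun γ.a = x ∧ γ.toFun γ.b = y}

open scoped Classical in
/-- The essential metric `d_ess(x,y) = essℓ(Γ(x,y))` for `x ≠ y`, and `0` on the diagonal. -/
noncomputable def dEss (μ : Measure X) (x y : X) : ℝ≥0∞ :=
  if x = y then 0 else essLen μ (ConnCurves x y)

end Modulus

section Modulus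

variable {X : Type*} [MetricSpace X] [MeasurableSpace X] {μ : Measure X}

theorem exceptional_iff_forall_exists_admissible {Γ : Set (Curve X)} :
    Exceptional μ Γ ↔ ∀ ε > 0, ∃ ρ, Admissible Γ ρ ∧ essSup ρ μ < ε := by
  rw [Exceptional, ModInfty, ← bot_eq_zero, iInf₂_eq_bot]
  simp only [Set.mem_ofPred_eq, exists_prop]

theorem Admissible.mono_right {Γ : Set (Curve X)} {ρ ρ' : X → ℝ≥0∞} (h : Admissible Γ ρ)
    (hρ' : Measurable ρ') (hle : ρ ≤ ρ') : Admissible Γ ρ' :=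
  ⟨hρ', fun γ hγ => (h.2 γ hγ).trans (lintegral_mono fun _ => hle _)⟩

theorem Exceptional.mono {Γ Δ : Set (Curve X)} (h : Exceptional μ Δ) (hsub : Γ ⊆ Δ) :
    Exceptional μ Γ := by
  rw [exceptional_iff_forall_exists_admissible] at h ⊢
  intro ε hε
  obtain ⟨ρ, hρ, hlt⟩ := h ε hε
  exact ⟨ρ, ⟨hρ.1, fun γ hγ => hρ.2 γ (hsub hγ)⟩, hlt⟩

theorem Exceptional.iUnion {ι : Type*} [Countable ι] {Γ : ι → Set (Curve X)}
    (h : ∀ i, Exceptional μ (Γ i)) : Exceptional μ (⋃ i, Γ i) := by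
  rw [exceptional_iff_forall_exists_admissible]
  intro ε hε
  obtain ⟨δ, hδ, hδε⟩ := exists_between hε
  choose ρ hρ hlt using fun i => exceptional_iff_forall_exists_admissible.1 (h i) δ hδ
  have hmeas : Measurable fun x => ⨆ i, ρ i x := .iSup fun i => (hρ i).1
  refine ⟨fun x => ⨆ i, ρ i x, ⟨hmeas, fun γ hγ => ?_⟩, lt_of_le_of_lt ?_ hδε⟩
  · obtain ⟨i, hi⟩ := Set.mem_iUnion.1 hγ
    exact ((hρ i).mono_right hmeas fun x => le_iSup (fun i => ρ i x) i).2 γ hi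
  · refine essSup_le_of_ae_le δ ?_
    filter_upwards [ae_all_iff.2 fun i => ENNReal.ae_le_essSup (μ := μ) (ρ i)] with x hx
    exact iSup_le fun i => (hx i).trans (hlt i).le

theorem exceptional_empty : Exceptional μ (∅ : Set (Curve X)) := by
  simpa using Exceptional.iUnion (μ := μ) (Γ := fun i : Empty => i.elim) fun i => i.elim

end Modulus

/-- If `a₀ = essℓ(Γ) < ∞`, then `Γ(a₀) = {γ ∈ Γ : length γ < a₀}` is `∞`-exceptional. -/
theorem exceptional_below_essLen {X : Type*} [MetricSpace X] [TopologicalSpace.SeparableSpace X]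
    [MeasurableSpace X] [BorelSpace X] (μ : Measure X)
    (hμ : ∀ x : X, ∃ r > 0, 0 < μ (Metric.ball x r) ∧ μ (Metric.ball x r) < ∞)
    (Γ : Set (Curve X)) (hΓ : ∀ γ ∈ Γ, γ.Rectifiable)
    (hfin : essLen μ Γ < ∞) :
    Exceptional μ {γ ∈ Γ | γ.length < essLen μ Γ} := by
  have hne : {a : ℝ≥0∞ | Exceptional μ {γ ∈ Γ | γ.length < a}}.Nonempty :=
    ⟨0, by simpa using exceptional_empty⟩
  obtain ⟨u, -, hu, hmem⟩ := exists_seq_tendsto_sSup hne (OrderTop.bddAbove _)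
  refine (Exceptional.iUnion hmem).mono fun γ hγ => ?_
  obtain ⟨n, hn⟩ := (hu.eventually_const_lt hγ.2).exists
  exact Set.mem_iUnion.2 ⟨n, hγ.1, hn⟩
end

section
/- If (X,d,μ) is a metric measure space, then the De Cecco–Palmieri metric coincides with the essential metric: d̂(x,y) = d_ess(x,y) for all x,y ∈ X. -/
open MeasureTheory
open scoped ENNReal

/-- For a null set `N`, `d_N(x,y)` is the infimal length of rectifiable curves connecting
`x` to `y` whose arc-length parametrization meets `N` in a set of Lebesgue measure zero. -/
noncomputable def dN {X : Type*} [MetricSpace X] (N : Set X) (x y : X) : ℝ≥0∞ :=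
  ⨅ γ ∈ {γ : Curve X | γ.Rectifiable ∧ γ.toFun γ.a = x ∧ γ.toFun γ.b = y ∧
      volume (γ.paramDomain ∩ γ.param ⁻¹' N) = 0}, γ.length

open scoped Classical in
/-- The De Cecco–Palmieri metric `d̂(x,y) = sup {d_N(x,y) : N ⊆ X, μ N = 0}` for `x ≠ y`,
and `0` on the diagonal. -/
noncomputable def dHat {X : Type*} [MetricSpace X] [MeasurableSpace X]
    (μ : Measure X) (x y : X) : ℝ≥0∞ :=
  if x = y then 0 else ⨆ N ∈ {N : Set X | μ N = 0}, dN N x y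

/-- The variation from the left end point of an interval is a continuous function of the right
end point, for a continuous function of bounded variation. -/
theorem BoundedVariationOn.continuousOn_toReal_eVariationOn_Icc {E : Type*} [PseudoEMetricSpace E]
    {f : ℝ → E} {a b : ℝ} (hf : BoundedVariationOn f (Set.Icc a b))
    (hc : ContinuousOn f (Set.Icc a b)) :
    ContinuousOn (fun t ↦ (eVariationOn f (Set.Icc a t)).toReal) (Set.Icc a b) := by
  intro x hx
  have key : ∀ p ∈ Set.Icc a b, ∀ q ∈ Set.Icc a b, p ≤ q →
      (eVariationOn f (Set.Icc a q)).toReal - (eVariationOn f (Set.Icc a p)).toReal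
        = (eVariationOn f (Set.Icc a b ∩ Set.Icc p q)).toReal := by
    intro p hp q hq hpq
    have h := eVariationOn.Icc_add_Icc f hp.1 hpq hp
    have hp' : Set.Icc a b ∩ Set.Icc a p = Set.Icc a p :=
      Set.inter_eq_right.2 (Set.Icc_subset_Icc_right hp.2)
    have hq' : Set.Icc a b ∩ Set.Icc a q = Set.Icc a q :=
      Set.inter_eq_right.2 (Set.Icc_subset_Icc_right hq.2)
    rw [hp', hq'] at h
    rw [← h, ENNReal.toReal_add (hf.mono (Set.Icc_subset_Icc_right hp.2))
      (hf.mono Set.inter_subset_left)]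
    ring
  have hl := (ENNReal.tendsto_toReal ENNReal.zero_ne_top).comp
    (hf.tendsto_eVariationOn_Icc_zero_left ((hc x hx).mono Set.inter_subset_left))
  have hr := (ENNReal.tendsto_toReal ENNReal.zero_ne_top).comp
    (hf.tendsto_eVariationOn_Icc_zero_right x ((hc x hx).mono Set.inter_subset_left))
  have hsum := hl.add hr
  rw [ENNReal.toReal_zero, add_zero] at hsum
  rw [ContinuousWithinAt, tendsto_iff_dist_tendsto_zero]
  refine squeeze_zero' (Filter.Eventually.of_forall fun _ ↦ dist_nonneg) ?_ hsum
  filter_upwards [self_mem_nhdsWithin] with y hy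
  simp only [Function.comp_apply]
  rcases le_total x y with hxy | hxy
  · rw [Real.dist_eq, key x hx y hy hxy, abs_of_nonneg ENNReal.toReal_nonneg]
    exact le_add_of_nonneg_left ENNReal.toReal_nonneg
  · rw [dist_comm, Real.dist_eq, key y hy x hx hxy, abs_of_nonneg ENNReal.toReal_nonneg]
    exact le_add_of_nonneg_right ENNReal.toReal_nonneg

namespace Curve

variable {X : Type*} [MetricSpace X] {γ : Curve X}

theorem Rectifiable.paramDomain_eq (hγ : γ.Rectifiable) :
    γ.paramDomain = Set.Icc 0 γ.length.toReal := by
  ext t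
  exact and_congr_right fun _ ↦ ENNReal.ofReal_le_iff_le_toReal hγ

theorem Rectifiable.measurableSet_paramDomain (hγ : γ.Rectifiable) :
    MeasurableSet γ.paramDomain :=
  hγ.paramDomain_eq ▸ measurableSet_Icc

theorem Rectifiable.volume_paramDomain (hγ : γ.Rectifiable) :
    volume γ.paramDomain = γ.length := by
  rw [hγ.paramDomain_eq, Real.volume_Icc, sub_zero, ENNReal.ofReal_toReal hγ]

theorem Rectifiable.monotoneOn_lenFun (hγ : γ.Rectifiable) :
    MonotoneOn γ.lenFun (Set.Icc γ.a γ.b) := fun _ _ _ ht hst ↦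
  ENNReal.toReal_mono (BoundedVariationOn.mono hγ (Set.Icc_subset_Icc_right ht.2))
    (eVariationOn.mono _ (Set.Icc_subset_Icc_right hst))

theorem Rectifiable.surjOn_lenFun (hγ : γ.Rectifiable) :
    Set.SurjOn γ.lenFun (Set.Icc γ.a γ.b) γ.paramDomain := by
  have h := intermediate_value_Icc γ.hab
    (BoundedVariationOn.continuousOn_toReal_eVariationOn_Icc hγ γ.cont)
  rwa [Set.Icc_self, eVariationOn.subsingleton _ Set.subsingleton_singleton, ENNReal.toReal_zero,
    ← length, ← hγ.paramDomain_eq] at h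

theorem bddAbove_lenFun_fiber (γ : Curve X) (t : ℝ) :
    BddAbove {s | s ∈ Set.Icc γ.a γ.b ∧ γ.lenFun s = t} :=
  ⟨γ.b, fun _ hs ↦ hs.1.2⟩

theorem Rectifiable.lenInv_mem_Icc (hγ : γ.Rectifiable) {t : ℝ} (ht : t ∈ γ.paramDomain) :
    γ.lenInv t ∈ Set.Icc γ.a γ.b := by
  obtain ⟨s, hs, hst⟩ := hγ.surjOn_lenFun ht
  exact ⟨hs.1.trans (le_csSup (γ.bddAbove_lenFun_fiber t) ⟨hs, hst⟩),
    csSup_le ⟨s, hs, hst⟩ fun _ hr ↦ hr.1.2⟩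

theorem Rectifiable.monotoneOn_lenInv (hγ : γ.Rectifiable) :
    MonotoneOn γ.lenInv γ.paramDomain := by
  intro s hs t ht hst
  rcases hst.eq_or_lt with rfl | hlt
  · exact le_rfl
  obtain ⟨p, hp⟩ := hγ.surjOn_lenFun hs
  obtain ⟨q, hq, hqt⟩ := hγ.surjOn_lenFun ht
  refine (csSup_le ⟨p, hp⟩ fun r hr ↦ ?_).trans (le_csSup (γ.bddAbove_lenFun_fiber t) ⟨hq, hqt⟩)
  by_contra! hqr
  have := hγ.monotoneOn_lenFun hq hr.1 hqr.le
  rw [hqt, hr.2] at this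
  exact this.not_gt hlt

theorem Rectifiable.aemeasurable_param [MeasurableSpace X] [BorelSpace X] (hγ : γ.Rectifiable) :
    AEMeasurable γ.param (volume.restrict γ.paramDomain) := by
  have hg : Continuous (Set.IccExtend γ.hab ((Set.Icc γ.a γ.b).domRestrict γ.toFun)) :=
    (continuousOn_iff_continuous_domRestrict.1 γ.cont).Icc_extend'
  refine (hg.measurable.comp_aemeasurable (aemeasurable_restrict_of_monotoneOn
    hγ.measurableSet_paramDomain hγ.monotoneOn_lenInv)).congr ?_
  filter_upwards [ae_restrict_mem hγ.measurableSet_paramDomain] with t ht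
  exact Set.IccExtend_of_mem _ _ (hγ.lenInv_mem_Icc ht)

theorem Rectifiable.lineIntegral_indicator_top [MeasurableSpace X] [BorelSpace X]
    (hγ : γ.Rectifiable) {N : Set X} (hN : MeasurableSet N) (hpos : γ.PosLength N) :
    γ.lineIntegral (N.indicator fun _ ↦ ∞) = ∞ := by
  have hm : AEMeasurable (fun t ↦ N.indicator (fun _ ↦ (∞ : ℝ≥0∞)) (γ.param t))
      (volume.restrict γ.paramDomain) :=
    (measurable_const.indicator hN).comp_aemeasurable hγ.aemeasurable_param
  by_contra h
  refine hpos.ne' ?_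
  have h' := ae_lt_top' hm h
  rw [ae_restrict_iff' hγ.measurableSet_paramDomain] at h'
  refine measure_mono_null ?_ h'
  rintro t ⟨ht, htN⟩ hlt
  have htN : γ.param t ∈ N := htN
  simpa [htN] using hlt ht

theorem Rectifiable.lineIntegral_le_mul_length (hγ : γ.Rectifiable) {ρ : X → ℝ≥0∞} {c : ℝ≥0∞}
    (h : ¬ γ.PosLength {x | c < ρ x}) : γ.lineIntegral ρ ≤ c * γ.length := by
  rw [← hγ.volume_paramDomain, ← setLIntegral_const]
  refine lintegral_mono_ae ?_
  rw [ae_restrict_iff' hγ.measurableSet_paramDomain]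
  refine measure_mono_null (fun t ht ↦ ?_) (nonpos_iff_eq_zero.1 (not_lt.1 h))
  simpa using ht

end Curve

section EssentialMetric

variable {X : Type*} [MetricSpace X] [MeasurableSpace X] {μ : Measure X}

/-- The rectifiable curves having positive length in a given null set form an exceptional
family. -/
theorem exceptional_of_posLength [BorelSpace X] {Γ : Set (Curve X)} {N : Set X}
    (hN : μ N = 0) (hΓ : ∀ γ ∈ Γ, γ.Rectifiable ∧ γ.PosLength N) : Exceptional μ Γ := by
  set M := toMeasurable μ N
  have hM : MeasurableSet M := measurableSet_toMeasurable μ N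
  have hadm : Admissible Γ (M.indicator fun _ ↦ ∞) := by
    refine ⟨measurable_const.indicator hM, fun γ hγ ↦ ?_⟩
    rw [(hΓ γ hγ).1.lineIntegral_indicator_top hM ((hΓ γ hγ).2.trans_le
      (measure_mono (Set.inter_subset_inter_right _
        (Set.preimage_mono (subset_toMeasurable μ N)))))]
    exact le_top
  refine nonpos_iff_eq_zero.1 ((iInf₂_le _ hadm).trans_eq ?_)
  rw [ENNReal.essSup_eq_zero_iff]
  exact indicator_meas_zero (by rw [measure_toMeasurable, hN])

/-- Every exceptional family of rectifiable curves has positive length in a common null set. -/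
theorem Exceptional.exists_null {Γ : Set (Curve X)} (h : Exceptional μ Γ)
    (hΓ : ∀ γ ∈ Γ, γ.Rectifiable) :
    ∃ N : Set X, μ N = 0 ∧ ∀ γ ∈ Γ, γ.PosLength N := by
  have hρ : ∀ n : ℕ, ∃ ρ : X → ℝ≥0∞, Admissible Γ ρ ∧ essSup ρ μ < (n : ℝ≥0∞)⁻¹ := by
    intro n
    have hlt : ModInfty μ Γ < (n : ℝ≥0∞)⁻¹ := by
      rw [show ModInfty μ Γ = 0 from h]
      exact ENNReal.inv_pos.2 (ENNReal.natCast_ne_top n)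
    obtain ⟨ρ, hρ⟩ := iInf_lt_iff.1 hlt
    obtain ⟨hadm, hρ⟩ := iInf_lt_iff.1 hρ
    exact ⟨ρ, hadm, hρ⟩
  choose ρ hadm hess using hρ
  refine ⟨⋃ n : ℕ, {x | (n : ℝ≥0∞)⁻¹ < ρ n x}, measure_iUnion_null fun n ↦ ?_, fun γ hγ ↦ ?_⟩
  · refine measure_mono_null (fun x hx ↦ ?_) (ENNReal.ae_le_essSup (ρ n))
    exact not_le.2 ((hess n).trans hx)
  · by_contra hpos
    obtain ⟨n, hn⟩ := ENNReal.exists_nat_gt (hΓ γ hγ)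
    have hle : γ.lineIntegral (ρ n) ≤ (n : ℝ≥0∞)⁻¹ * γ.length :=
      (hΓ γ hγ).lineIntegral_le_mul_length fun hn ↦ hpos <| hn.trans_le <| measure_mono <|
        Set.inter_subset_inter_right _ <| Set.preimage_mono <|
          Set.subset_iUnion (fun n : ℕ ↦ {x | (n : ℝ≥0∞)⁻¹ < ρ n x}) n
    have hone := ((hadm n).2 γ hγ).trans hle
    rw [mul_comm, ← div_eq_mul_inv] at hone
    refine hone.not_gt ?_
    rw [ENNReal.div_lt_iff (Or.inl (ne_bot_of_gt hn)) (Or.inl (ENNReal.natCast_ne_top n)), one_mul]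
    exact hn

theorem dN_le_essLen [BorelSpace X] {N : Set X} (hN : μ N = 0) (x y : X) :
    dN N x y ≤ essLen μ (ConnCurves x y) := by
  refine le_sSup (exceptional_of_posLength hN ?_)
  rintro γ ⟨⟨hrect, hx, hy⟩, hlt⟩
  refine ⟨hrect, pos_iff_ne_zero.2 fun h0 ↦ hlt.not_ge ?_⟩
  exact iInf₂_le γ ⟨hrect, hx, hy, h0⟩

theorem essLen_le_iSup_dN (μ : Measure X) (x y : X) :
    essLen μ (ConnCurves x y) ≤ ⨆ N ∈ {N : Set X | μ N = 0}, dN N x y := by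
  refine sSup_le fun a ha ↦ ?_
  obtain ⟨N, hN, hpos⟩ := Exceptional.exists_null ha fun γ hγ ↦ hγ.1.1
  refine le_trans ?_ (le_iSup₂ (f := fun (N : Set X) _ ↦ dN N x y) N hN)
  refine le_iInf₂ fun γ ⟨hrect, hx, hy, h0⟩ ↦ ?_
  by_contra! hlt
  exact (hpos γ ⟨⟨hrect, hx, hy⟩, hlt⟩).ne' h0

end EssentialMetric

/-- The De Cecco–Palmieri metric coincides with the essential metric: `d̂ = d_ess`. -/
theorem dHat_eq_dEss {X : Type*} [MetricSpace X] [TopologicalSpace.SeparableSpace X]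
    [MeasurableSpace X] [BorelSpace X] (μ : Measure X)
    (hμ : ∀ x : X, ∃ r > 0, 0 < μ (Metric.ball x r) ∧ μ (Metric.ball x r) < ∞) :
    ∀ x y : X, dHat μ x y = dEss μ x y := by
  intro x y
  unfold dHat dEss
  split_ifs
  · rfl
  · exact le_antisymm (iSup₂_le fun N hN ↦ dN_le_essLen hN x y) (essLen_le_iSup_dN μ x y)
end
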